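/- Let f be a mixing piecewise expanding unimodal map with C² branches, with critical point c, and let ρ be the density of its unique absolutely continuous invariant probability measure; assume ρ(c) > 0. If the forward orbit {c_j = f^j(c)}_{j ≥ 1} of the critical point is dense in [0,1], then the set of points of [0,1] at which ρ is not differentiable is uncountable. -/

import Mathlib

open MeasureTheory Set Filter Topology Asymptotics
open scoped ENNReal NNReal

/-- `BoundedVariationOn` on the unit interval. -/
def bvOn (φ : ℝ → ℝ) : Prop := BoundedVariationOn φ (Set.Icc 0 1)

/-- The supremum norm of `φ` over `[0,1]`. -/
noncomputable def supNorm (φ : ℝ → ℝ) : ℝ := ⨆ x : Set.Icc (0:ℝ) 1, |φ (x : ℝ)|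

/-- The total variation of `φ` over `[0,1]`, as a real number. -/
noncomputable def var01 (φ : ℝ → ℝ) : ℝ := (eVariationOn φ (Set.Icc 0 1)).toReal

/-- The BV norm `‖φ‖_BV = ‖φ‖_∞ + var(φ)` on `[0,1]`. -/
noncomputable def bvNorm (φ : ℝ → ℝ) : ℝ := supNorm φ + var01 φ

/-- The BV norm with values in `ℝ≥0∞` (no junk values). -/
noncomputable def eBVnorm (φ : ℝ → ℝ) : ℝ≥0∞ :=
  (⨆ x : Set.Icc (0:ℝ) 1, (‖φ (x : ℝ)‖₊ : ℝ≥0∞)) + eVariationOn φ (Set.Icc 0 1)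

/-- The Heaviside-type function `H_a` with value `1` left of `a`, `1/2` at `a`, `0` right of `a`. -/
noncomputable def Hstep (a x : ℝ) : ℝ := if x < a then 1 else if x = a then 1/2 else 0

/-- A piecewise expanding unimodal map (PEUM) of `[0,1]`: a map `f` with critical point
`c ∈ (0,1)` whose two branches `f₁` (on `[0, c+ε]`) and `f₂` (on `[c-ε, 1]`) are `C²` and
satisfy `|Df_j| ≥ λ > 1`. -/
structure PEUM where
  f : ℝ → ℝ
  c : ℝ
  eps : ℝ
  lam : ℝ
  f₁ : ℝ → ℝ
  f₂ : ℝ → ℝ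
  mapsTo : Set.MapsTo f (Set.Icc (0:ℝ) 1) (Set.Icc (0:ℝ) 1)
  c_mem : c ∈ Set.Ioo (0:ℝ) 1
  eps_pos : 0 < eps
  lam_gt_one : 1 < lam
  smooth₁ : ContDiffOn ℝ 2 f₁ (Set.Icc 0 (c + eps))
  smooth₂ : ContDiffOn ℝ 2 f₂ (Set.Icc (c - eps) 1)
  eq₁ : ∀ x ∈ Set.Icc (0:ℝ) 1, x ≤ c → f x = f₁ x
  eq₂ : ∀ x ∈ Set.Icc (0:ℝ) 1, c ≤ x → f x = f₂ x
  branch_eq : f₁ c = f₂ c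
  expand₁ : ∀ x ∈ Set.Icc 0 (c + eps), lam ≤ |deriv f₁ x|
  expand₂ : ∀ x ∈ Set.Icc (c - eps) 1, lam ≤ |deriv f₂ x|

namespace PEUM

/-- Both branches of `P` are of class `C^r`. -/
def BranchSmooth (P : PEUM) (r : ℕ) : Prop :=
  ContDiffOn ℝ r P.f₁ (Set.Icc 0 (P.c + P.eps)) ∧
  ContDiffOn ℝ r P.f₂ (Set.Icc (P.c - P.eps) 1)

/-- The weighted transfer operator `𝓛_m φ(x) = Σ_{f(y)=x} φ(y)/((Df(y))^m |Df(y)|)`,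
the sum ranging over preimages `y ∈ [0,1]` of `x`. -/
noncomputable def transfer (P : PEUM) (m : ℕ) (φ : ℝ → ℝ) : ℝ → ℝ := fun x =>
  ∑' y : {y : ℝ // y ∈ Set.Icc (0:ℝ) 1 ∧ P.f y = x},
    φ y.1 / ((deriv P.f y.1) ^ m * |deriv P.f y.1|)

/-- The Perron–Frobenius operator `𝓛 = 𝓛₀`. -/
noncomputable def PF (P : PEUM) : (ℝ → ℝ) → ℝ → ℝ := P.transfer 0

/-- `ξ(z) = D²f(z)/Df(z)`. -/
noncomputable def xi (P : PEUM) : ℝ → ℝ := fun z => deriv (deriv P.f) z / deriv P.f z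

/-- The measure `ρ dx` on `[0,1]`. -/
noncomputable def invMeasure (P : PEUM) (ρ : ℝ → ℝ) : Measure ℝ :=
  (volume.restrict (Set.Icc (0:ℝ) 1)).withDensity fun x => ENNReal.ofReal (ρ x)

/-- `ρ` is the (BV representative of the) density of the absolutely continuous invariant
probability measure of `P`: it is nonnegative, of bounded variation, `ρ dx` is an
`f`-invariant probability measure, and `𝓛ρ = ρ` on `[0,1]`. -/
def IsInvariantDensity (P : PEUM) (ρ : ℝ → ℝ) : Prop :=
  bvOn ρ ∧ (∀ x, 0 ≤ ρ x) ∧ IsProbabilityMeasure (P.invMeasure ρ) ∧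
    (P.invMeasure ρ).map P.f = P.invMeasure ρ ∧
    ∀ x ∈ Set.Icc (0:ℝ) 1, P.PF ρ x = ρ x

/-- Exponential mixing at rate `θ < 1`:
`𝓛ⁿh = (∫₀¹ h) ρ + O(θⁿ ‖h‖_BV)` for all `h` of bounded variation. -/
def Mixing (P : PEUM) (ρ : ℝ → ℝ) (θ : ℝ) : Prop :=
  0 < θ ∧ θ < 1 ∧ ∃ C : ℝ, 0 < C ∧ ∀ h : ℝ → ℝ, bvOn h → ∀ n : ℕ, ∀ x ∈ Set.Icc (0:ℝ) 1,
    |(P.PF)^[n] h x - (∫ z in Set.Icc (0:ℝ) 1, h z) * ρ x| ≤ C * θ ^ n * bvNorm h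

/-- `ρ₁ = −Σ_{i=1}^∞ 𝓛₁^i(ξ·ρ)` (pointwise sum of the series). -/
noncomputable def rho1 (P : PEUM) (ρ : ℝ → ℝ) : ℝ → ℝ := fun x =>
  -∑' i : ℕ, (P.transfer 1)^[i + 1] (fun y => P.xi y * ρ y) x

/-- The operator `𝔇^{i₁,…,i_k}_{m₁,…,m_k}(h₁,…,h_k)`, encoded on the list
`[(i₁,m₁,h₁),…,(i_k,m_k,h_k)]` by `𝔇((i,m,h) :: rest) = 𝓛_m^i (h · 𝔇(rest))`. -/
noncomputable def DD (P : PEUM) : List (ℕ × ℕ × (ℝ → ℝ)) → ℝ → ℝ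
  | [] => fun _ => 1
  | p :: rest => (P.transfer p.2.1)^[p.1] fun x => p.2.2 x * P.DD rest x

/-- The set `𝒩_β` of points approached exponentially fast (at rate `β`) by the critical
orbit: `|c_n − x| ≤ βⁿ` for infinitely many `n`. -/
def Nbeta (P : PEUM) (β : ℝ) : Set ℝ :=
  {x ∈ Set.Icc (0:ℝ) 1 | ∃ᶠ n in Filter.atTop, |P.f^[n] P.c - x| ≤ β ^ n}

end PEUM

/-- A function on `ℝ` whose points of non-differentiability in `[0,1]` form a countable set is
continuous on a nonempty open subset of `[0,1]`. -/
theorem exists_ball_continuousAt_of_countable {φ : ℝ → ℝ}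
    (h : Set.Countable {x ∈ Set.Icc (0:ℝ) 1 | ¬ DifferentiableAt ℝ φ x}) :
    ∃ p r : ℝ, 0 < r ∧ Metric.ball p r ⊆ Set.Ioo 0 1 ∧
      ∀ z ∈ Metric.ball p r, ContinuousAt φ z := by
  set s : Set ℝ := {x ∈ Set.Icc (0:ℝ) 1 | ¬ DifferentiableAt ℝ φ x} with hs
  set A : ℕ → Set ℝ := fun n =>
    {x | x ∈ Set.Icc (0:ℝ) 1 → ∀ y, |y - x| < 1 / (n + 1 : ℝ) → |φ y - φ x| ≤ n * |y - x|} with hA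
  have hcover : sᶜ ⊆ ⋃ n, closure (A n) := by
    intro x hx
    refine mem_iUnion.2 ?_
    suffices ∃ n, x ∈ A n from this.imp fun n hn => subset_closure hn
    by_cases hxI : x ∈ Set.Icc (0:ℝ) 1
    · have hd : DifferentiableAt ℝ φ x := by
        by_contra hd
        exact hx ⟨hxI, hd⟩
      obtain ⟨C, hC⟩ := hd.isBigO_sub.bound
      obtain ⟨δ, hδ, hball⟩ := Metric.eventually_nhds_iff.1 hC
      obtain ⟨n₁, hn₁⟩ := exists_nat_ge C
      obtain ⟨n₂, hn₂⟩ := exists_nat_one_div_lt hδ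
      refine ⟨max n₁ n₂, fun _ y hy => ?_⟩
      have h₁ : (1 : ℝ) / (((max n₁ n₂ : ℕ) : ℝ) + 1) ≤ 1 / (n₂ + 1 : ℝ) := by
        apply one_div_le_one_div_of_le (by positivity)
        have : (n₂ : ℝ) ≤ ((max n₁ n₂ : ℕ) : ℝ) := by exact_mod_cast le_max_right _ _
        linarith
      have h₂ : (n₁ : ℝ) ≤ ((max n₁ n₂ : ℕ) : ℝ) := by exact_mod_cast le_max_left _ _
      have h₃ := hball (y := y) (by rw [Real.dist_eq]; linarith)
      simp only [Real.norm_eq_abs] at h₃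
      exact h₃.trans (mul_le_mul_of_nonneg_right (hn₁.trans h₂) (abs_nonneg _))
    · exact ⟨0, fun h' => absurd h' hxI⟩
  have hdense : Dense (⋃ n, interior (closure (A n))) :=
    IsGδ.dense_iUnion_interior_of_closed h.isGδ_compl (h.dense_compl ℝ)
      (fun _ => isClosed_closure) hcover
  obtain ⟨p, hp, hpU⟩ := hdense.exists_mem_open (isOpen_Ioo (a := (0:ℝ)) (b := 1))
    ⟨1 / 2, by norm_num, by norm_num⟩
  obtain ⟨n, hn⟩ := mem_iUnion.1 hp
  have hnear : interior (closure (A n)) ∩ Set.Ioo 0 1 ∈ 𝓝 p :=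
    inter_mem (isOpen_interior.mem_nhds hn) (isOpen_Ioo.mem_nhds hpU)
  obtain ⟨r₀, hr₀, hball⟩ := Metric.mem_nhds_iff.1 hnear
  have hn0 : (0 : ℝ) < 1 / (n + 1 : ℝ) := by positivity
  set r := min r₀ (1 / (n + 1 : ℝ) / 2) with hr
  have hsub : Metric.ball p r ⊆ interior (closure (A n)) ∩ Set.Ioo 0 1 :=
    (Metric.ball_subset_ball (min_le_left _ _)).trans hball
  have key : ∀ z ∈ Metric.ball p r, ∀ w ∈ Metric.ball p r, |φ w - φ z| ≤ n * |w - z| := by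
    intro z hz w hw
    have hzcl : z ∈ closure (Metric.ball p r ∩ A n) :=
      Metric.isOpen_ball.inter_closure ⟨hz, interior_subset (hsub hz).1⟩
    have hclosed : IsClosed {x : ℝ | |φ w - φ z| ≤ n * |w - x| + n * |z - x|} :=
      isClosed_le continuous_const (by fun_prop)
    have hmem : z ∈ {x : ℝ | |φ w - φ z| ≤ n * |w - x| + n * |z - x|} := by
      refine closure_minimal ?_ hclosed hzcl
      rintro x ⟨hx, hxA⟩
      have hclose : ∀ u ∈ Metric.ball p r, |u - x| < 1 / (n + 1 : ℝ) := by
        intro u hu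
        have hr2 : r ≤ 1 / (n + 1 : ℝ) / 2 := min_le_right _ _
        rw [Metric.mem_ball] at hu hx
        have := dist_triangle_right u x p
        rw [← Real.dist_eq]
        linarith
      have hxI := Ioo_subset_Icc_self (hsub hx).2
      have h₁ := hxA hxI w (hclose w hw)
      have h₂ := hxA hxI z (hclose z hz)
      have h₃ := abs_sub_le (φ w) (φ x) (φ z)
      rw [abs_sub_comm (φ x)] at h₃
      simp only [mem_ofPred_eq]
      linarith
    simpa using hmem
  refine ⟨p, r, lt_min hr₀ (by positivity), fun z hz => (hsub hz).2, fun z hz => ?_⟩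
  rw [ContinuousAt, tendsto_iff_norm_sub_tendsto_zero]
  refine squeeze_zero' (Eventually.of_forall fun _ => norm_nonneg _)
    (g := fun w => n * |w - z|) ?_ ?_
  · filter_upwards [Metric.isOpen_ball.mem_nhds hz] with w hw using key z hz w hw
  · have : Continuous fun w : ℝ => (n : ℝ) * |w - z| := by fun_prop
    simpa using this.tendsto z

/-- A continuous injective function on a compact interval extends to a homeomorphism of `ℝ`. -/
theorem exists_homeomorph_extend {g : ℝ → ℝ} {a b : ℝ} (hab : a ≤ b)
    (hg : ContinuousOn g (Set.Icc a b)) (hinj : Set.InjOn g (Set.Icc a b)) :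
    ∃ F : ℝ ≃ₜ ℝ, ∀ x ∈ Set.Icc a b, F x = g x := by
  have mono_case : ∀ g : ℝ → ℝ, ContinuousOn g (Set.Icc a b) → StrictMonoOn g (Set.Icc a b) →
      ∃ F : ℝ ≃ₜ ℝ, ∀ x ∈ Set.Icc a b, F x = g x := by
    intro g hg hmono
    set k : ℝ → ℝ := fun x => max a (min b x) with hk
    have hkI : ∀ x, k x ∈ Set.Icc a b := fun x =>
      ⟨le_max_left _ _, max_le hab (min_le_left _ _)⟩
    have hkc : Continuous k := by fun_prop
    have hkid : ∀ x ∈ Set.Icc a b, k x = x := fun x hx => by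
      simp [hk, min_eq_right hx.2, max_eq_right hx.1]
    set m : ℝ → ℝ := fun x => g (k x) + (x - k x) with hm
    have hmc : Continuous m :=
      (hg.comp_continuous hkc hkI).add (continuous_id.sub hkc)
    have hkmono : Monotone k := fun x y hxy => max_le_max le_rfl (min_le_min le_rfl hxy)
    have hkone : ∀ x y, x ≤ y → k y - k x ≤ y - x := by
      intro x y hxy
      simp only [hk]
      rcases max_cases a (min b x) with h₁ | h₁ <;> rcases max_cases a (min b y) with h₂ | h₂ <;>
      rcases min_cases b x with h₃ | h₃ <;> rcases min_cases b y with h₄ | h₄ <;> linarith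
    have hmm : StrictMono m := by
      intro x y hxy
      have h₁ := hkone x y hxy.le
      rcases (hkmono hxy.le).lt_or_eq with h₂ | h₂
      · have := hmono (hkI x) (hkI y) h₂
        simp only [hm]
        linarith
      · simp only [hm, h₂]
        linarith
    have hbd : ∀ x, g a ≤ g (k x) ∧ g (k x) ≤ g b := fun x =>
      ⟨hmono.monotoneOn ⟨le_rfl, hab⟩ (hkI x) (hkI x).1,
        hmono.monotoneOn (hkI x) ⟨hab, le_rfl⟩ (hkI x).2⟩
    have htop : Tendsto m atTop atTop := by
      refine tendsto_atTop_mono (f := fun x => x + (g a - b)) (fun x => ?_)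
        (tendsto_atTop_add_const_right _ _ tendsto_id)
      have := (hbd x).1
      have := (hkI x).2
      simp only [hm]
      linarith
    have hbot : Tendsto m atBot atBot := by
      refine tendsto_atBot_mono (f := fun x => x + (g b - a)) (fun x => ?_)
        (tendsto_atBot_add_const_right _ _ tendsto_id)
      have := (hbd x).2
      have := (hkI x).1
      simp only [hm]
      linarith
    have hsurj : Function.Surjective m := hmc.surjective htop hbot
    refine ⟨(hmm.orderIsoOfSurjective m hsurj).toHomeomorph, fun x hx => ?_⟩
    simp [hm, hkid x hx]
  rcases hg.strictMonoOn_of_injOn_Icc' hab hinj with h | h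
  · exact mono_case g hg h
  · obtain ⟨F, hF⟩ := mono_case (fun x => -g x) hg.neg h.neg
    exact ⟨F.trans (Homeomorph.neg ℝ), fun x hx => by simp [hF x hx]⟩

/-- `F` and `d` extend to `ℝ` the restriction of `f` to `[a,b]` as a homeomorphism, and the
absolute value of its derivative as a positive continuous function. -/
structure IsBranch (f : ℝ → ℝ) (a b : ℝ) (F : ℝ ≃ₜ ℝ) (d : ℝ → ℝ) : Prop where
  cont : Continuous d
  pos : ∀ x, 0 < d x
  eq : ∀ x ∈ Set.Icc a b, F x = f x
  deriv_eq : ∀ x ∈ Set.Ioo a b, |deriv f x| = d x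

theorem mul_sub_le_abs_sub {g : ℝ → ℝ} {a b lam : ℝ} (hab : a < b) (hlam : 0 < lam)
    (hder : ∀ x ∈ Set.Icc a b, lam ≤ |deriv g x|) : lam * (b - a) ≤ |g b - g a| := by
  have hdiff : ∀ x ∈ Set.Icc a b, DifferentiableAt ℝ g x := fun x hx =>
    differentiableAt_of_deriv_ne_zero (abs_pos.1 (hlam.trans_le (hder x hx)))
  obtain ⟨ξ, hξ, hslope⟩ := exists_deriv_eq_slope g hab
    (fun x hx => (hdiff x hx).continuousAt.continuousWithinAt)
    (fun x hx => (hdiff x (Ioo_subset_Icc_self hx)).differentiableWithinAt)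
  have hba : 0 < b - a := sub_pos.2 hab
  have h := hder ξ (Ioo_subset_Icc_self hξ)
  rwa [hslope, abs_div, abs_of_pos hba, le_div_iff₀ hba] at h

theorem exists_isBranch {f g : ℝ → ℝ} {a b lam : ℝ} (hab : a < b) (hlam : 0 < lam)
    (hder : ∀ x ∈ Set.Icc a b, lam ≤ |deriv g x|) (hcont : ContinuousOn (deriv g) (Set.Icc a b))
    (hfg : Set.EqOn f g (Set.Icc a b)) : ∃ F d, IsBranch f a b F d := by
  have hdiff : ∀ x ∈ Set.Icc a b, DifferentiableAt ℝ g x := fun x hx =>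
    differentiableAt_of_deriv_ne_zero (abs_pos.1 (hlam.trans_le (hder x hx)))
  have hlt : ∀ x ∈ Set.Icc a b, ∀ y ∈ Set.Icc a b, x < y → g x ≠ g y := by
    intro x hx y hy hxy heq
    have h := mul_sub_le_abs_sub hxy hlam
      (fun z hz => hder z ⟨hx.1.trans hz.1, hz.2.trans hy.2⟩)
    rw [heq, sub_self, abs_zero] at h
    have := mul_pos hlam (sub_pos.2 hxy)
    linarith
  have hinj : Set.InjOn g (Set.Icc a b) := by
    intro x hx y hy heq
    by_contra hne
    rcases lt_or_gt_of_ne hne with h | h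
    · exact hlt x hx y hy h heq
    · exact hlt y hy x hx h heq.symm
  obtain ⟨F, hF⟩ := exists_homeomorph_extend hab.le
    (fun x hx => (hdiff x hx).continuousAt.continuousWithinAt) hinj
  have hkI : ∀ x, max a (min b x) ∈ Set.Icc a b := fun x =>
    ⟨le_max_left _ _, max_le hab.le (min_le_left _ _)⟩
  refine ⟨F, fun x => |deriv g (max a (min b x))|, ?_, fun x => hlam.trans_le (hder _ (hkI x)),
    fun x hx => by rw [hF x hx, hfg hx], fun x hx => ?_⟩
  · exact (hcont.comp_continuous (by fun_prop) hkI).abs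
  · have : f =ᶠ[𝓝 x] g := by
      filter_upwards [isOpen_Ioo.mem_nhds hx] with y hy using hfg (Ioo_subset_Icc_self hy)
    rw [this.deriv_eq, min_eq_right hx.2.le, max_eq_right hx.1.le]

theorem continuousOn_deriv_of_contDiffOn {g : ℝ → ℝ} {a b lam : ℝ} (hab : a < b) (hlam : 0 < lam)
    (hder : ∀ x ∈ Set.Icc a b, lam ≤ |deriv g x|) (hg : ContDiffOn ℝ 2 g (Set.Icc a b)) :
    ContinuousOn (deriv g) (Set.Icc a b) := by
  refine (hg.continuousOn_derivWithin (uniqueDiffOn_Icc hab) (by norm_num)).congr fun x hx => ?_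
  exact ((differentiableAt_of_deriv_ne_zero
    (abs_pos.1 (hlam.trans_le (hder x hx)))).derivWithin (uniqueDiffOn_Icc hab x hx)).symm

/-- The contribution to the transfer operator of the branch over `(a,b)`. -/
noncomputable def branchPush (a b : ℝ) (F : ℝ ≃ₜ ℝ) (d φ : ℝ → ℝ) (x : ℝ) : ℝ :=
  (Set.Ioo a b).indicator φ (F.symm x) / d (F.symm x)

theorem eventually_ne_punctured (x a : ℝ) : ∀ᶠ z in 𝓝[≠] x, z ≠ a := by
  rcases eq_or_ne x a with rfl | h
  · exact self_mem_nhdsWithin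
  · exact mem_nhdsWithin_of_mem_nhds (isOpen_ne.mem_nhds h)

theorem continuousAt_indicator_Ioo {φ : ℝ → ℝ} {a b y : ℝ} (ha : y ≠ a) (hb : y ≠ b)
    (h : y ∈ Set.Ioo a b → ContinuousAt φ y) :
    ContinuousAt ((Set.Ioo a b).indicator φ) y := by
  by_cases hy : y ∈ Set.Ioo a b
  · refine (h hy).congr ?_
    filter_upwards [isOpen_Ioo.mem_nhds hy] with z hz
    rw [indicator_of_mem hz]
  · have hy' : y ∈ (Set.Icc a b)ᶜ := fun hI =>
      hy ⟨lt_of_le_of_ne hI.1 ha.symm, lt_of_le_of_ne hI.2 hb⟩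
    refine (continuousAt_const (y := (0 : ℝ))).congr ?_
    filter_upwards [isClosed_Icc.isOpen_compl.mem_nhds hy'] with z hz
    rw [indicator_of_notMem fun h => hz (Ioo_subset_Icc_self h)]

theorem tendsto_homeomorph_punctured (F : ℝ ≃ₜ ℝ) (y : ℝ) :
    Tendsto F (𝓝[≠] y) (𝓝[≠] (F y)) :=
  F.continuous.continuousWithinAt.tendsto_nhdsWithin fun _ hz h => hz (F.injective h)

namespace IsBranch

variable {f φ : ℝ → ℝ} {a b : ℝ} {F : ℝ ≃ₜ ℝ} {d : ℝ → ℝ}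

theorem continuousAt_branchPush (h : IsBranch f a b F d) {x : ℝ}
    (hφ : ContinuousAt ((Set.Ioo a b).indicator φ) (F.symm x)) :
    ContinuousAt (branchPush a b F d φ) x :=
  (hφ.comp F.symm.continuous.continuousAt).div
    (h.cont.comp F.symm.continuous).continuousAt (h.pos _).ne'

theorem branchPush_nonneg (h : IsBranch f a b F d) (hφ : ∀ x, 0 ≤ φ x) (x : ℝ) :
    0 ≤ branchPush a b F d φ x :=
  div_nonneg (indicator_nonneg (fun z _ => hφ z) _) (h.pos _).le

open Classical in
theorem ite_branchPush (h : IsBranch f a b F d) (x y : ℝ) :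
    (if y = F.symm x then branchPush a b F d φ x else 0) =
      if y ∈ Set.Ioo a b ∧ f y = x then φ y / |deriv f y| else 0 := by
  by_cases hy : y ∈ Set.Ioo a b
  · have hiff : y = F.symm x ↔ f y = x := by
      rw [← h.eq y (Ioo_subset_Icc_self hy), F.eq_symm_apply]
    by_cases hyx : y = F.symm x
    · rw [if_pos hyx, if_pos ⟨hy, hiff.1 hyx⟩, branchPush, ← hyx, indicator_of_mem hy,
        h.deriv_eq y hy]
    · rw [if_neg hyx, if_neg fun h' => hyx (hiff.2 h'.2)]
  · rw [if_neg (c := y ∈ Set.Ioo a b ∧ f y = x) fun h' => hy h'.1]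
    split_ifs with hyx
    · simp only [branchPush]
      rw [← hyx, indicator_of_notMem hy, zero_div]
    · rfl

/-- If `φ` is a fixed point of a two-branch transfer operator with a limit at `f y`, and `φ` is
continuous at the preimage of `f y` on the second branch, then `φ` has a limit at `y` from inside
the first branch. -/
theorem exists_limit_of_limit_image (h : IsBranch f a b F d) {a' b' : ℝ} {F' : ℝ ≃ₜ ℝ}
    {d' : ℝ → ℝ} (h' : IsBranch f a' b' F' d') (hab' : a' ≤ b') {y L : ℝ} (hy : y ∈ Set.Icc a b)
    (hrep : ∀ᶠ x in 𝓝[≠] (f y), φ x = branchPush a b F d φ x + branchPush a' b' F' d' φ x)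
    (hother : ∀ z ∈ Set.Icc a' b', f z = f y → z ≠ a' ∧ z ≠ b' ∧ ContinuousAt φ z)
    (hL : Tendsto φ (𝓝[≠] (f y)) (𝓝 L)) :
    ∃ L', Tendsto ((Set.Ioo a b).indicator φ) (𝓝[≠] y) (𝓝 L') := by
  rw [← h.eq y hy] at hrep hother hL
  set y' := F'.symm (F y) with hy'
  have hI : y' ∈ Set.Icc a' b' → y' ≠ a' ∧ y' ≠ b' ∧ ContinuousAt φ y' := fun hm =>
    hother y' hm (by rw [← h'.eq y' hm, hy', F'.apply_symm_apply])
  have hne : y' ≠ a' ∧ y' ≠ b' := by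
    refine ⟨fun he => ?_, fun he => ?_⟩
    · exact (hI (by rw [he]; exact ⟨le_rfl, hab'⟩)).1 he
    · exact (hI (by rw [he]; exact ⟨hab', le_rfl⟩)).2.1 he
  have hc : ContinuousAt (branchPush a' b' F' d' φ) (F y) :=
    h'.continuousAt_branchPush (continuousAt_indicator_Ioo hne.1 hne.2
      fun hm => (hI (Ioo_subset_Icc_self hm)).2.2)
  have h₁ : Tendsto (branchPush a b F d φ) (𝓝[≠] (F y))
      (𝓝 (L - branchPush a' b' F' d' φ (F y))) := by
    refine (hL.sub (hc.tendsto.mono_left nhdsWithin_le_nhds)).congr' ?_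
    filter_upwards [hrep] with x hx
    rw [hx, add_sub_cancel_right]
  refine ⟨_, ((h₁.comp (tendsto_homeomorph_punctured F y)).mul
    (h.cont.continuousAt.tendsto.mono_left nhdsWithin_le_nhds)).congr fun z => ?_⟩
  simp only [Function.comp, branchPush, F.symm_apply_apply]
  exact div_mul_cancel₀ _ (h.pos z).ne'

end IsBranch

namespace PEUM

variable (P : PEUM)

theorem exists_branches : ∃ F₁ d₁ F₂ d₂,
    IsBranch P.f 0 P.c F₁ d₁ ∧ IsBranch P.f P.c 1 F₂ d₂ := by
  have hlam : 0 < P.lam := one_pos.trans P.lam_gt_one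
  have hc := P.c_mem
  have he := P.eps_pos
  have sub₁ : Set.Icc 0 P.c ⊆ Set.Icc 0 (P.c + P.eps) := Icc_subset_Icc le_rfl (by linarith)
  have sub₂ : Set.Icc P.c 1 ⊆ Set.Icc (P.c - P.eps) 1 := Icc_subset_Icc (by linarith) le_rfl
  obtain ⟨F₁, d₁, h₁⟩ := exists_isBranch (f := P.f) (g := P.f₁) hc.1 hlam
    (fun x hx => P.expand₁ x (sub₁ hx))
    (continuousOn_deriv_of_contDiffOn hc.1 hlam (fun x hx => P.expand₁ x (sub₁ hx))
      (P.smooth₁.mono sub₁))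
    (fun x hx => P.eq₁ x ⟨hx.1, hx.2.trans hc.2.le⟩ hx.2)
  obtain ⟨F₂, d₂, h₂⟩ := exists_isBranch (f := P.f) (g := P.f₂) hc.2 hlam
    (fun x hx => P.expand₂ x (sub₂ hx))
    (continuousOn_deriv_of_contDiffOn hc.2 hlam (fun x hx => P.expand₂ x (sub₂ hx))
      (P.smooth₂.mono sub₂))
    (fun x hx => P.eq₂ x ⟨hc.1.le.trans hx.1, hx.2⟩ hx.1)
  exact ⟨F₁, d₁, F₂, d₂, h₁, h₂⟩

variable {P} {F₁ F₂ : ℝ ≃ₜ ℝ} {d₁ d₂ : ℝ → ℝ}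

theorem PF_eq_branchPush_add (h₁ : IsBranch P.f 0 P.c F₁ d₁) (h₂ : IsBranch P.f P.c 1 F₂ d₂)
    (φ : ℝ → ℝ) {x : ℝ} (hx0 : x ≠ P.f 0) (hxc : x ≠ P.f P.c) (hx1 : x ≠ P.f 1) :
    P.PF φ x = branchPush 0 P.c F₁ d₁ φ x + branchPush P.c 1 F₂ d₂ φ x := by
  classical
  have hc := P.c_mem
  have hsum := (hasSum_ite_eq (F₁.symm x) (branchPush 0 P.c F₁ d₁ φ x)).add
    (hasSum_ite_eq (F₂.symm x) (branchPush P.c 1 F₂ d₂ φ x))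
  rw [← hsum.tsum_eq, PF, transfer]
  refine (tsum_subtype {y : ℝ | y ∈ Set.Icc (0:ℝ) 1 ∧ P.f y = x}
    (fun y => φ y / ((deriv P.f y) ^ 0 * |deriv P.f y|))).trans ?_
  refine tsum_congr fun y => ?_
  rw [h₁.ite_branchPush, h₂.ite_branchPush, indicator_apply]
  simp only [mem_ofPred_eq, pow_zero, one_mul]
  by_cases hy : P.f y = x
  · have hy0 : y ≠ 0 := by rintro rfl; exact hx0 hy.symm
    have hyc : y ≠ P.c := by rintro rfl; exact hxc hy.symm
    have hy1 : y ≠ 1 := by rintro rfl; exact hx1 hy.symm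
    have e₁ : y ∈ Set.Ioo 0 P.c ↔ 0 < y ∧ y < P.c := Iff.rfl
    have e₂ : y ∈ Set.Ioo P.c 1 ↔ P.c < y ∧ y < 1 := Iff.rfl
    have e₃ : y ∈ Set.Icc (0:ℝ) 1 ↔ 0 < y ∧ y < 1 :=
      ⟨fun h => ⟨lt_of_le_of_ne h.1 hy0.symm, lt_of_le_of_ne h.2 hy1⟩,
        fun h => ⟨h.1.le, h.2.le⟩⟩
    simp only [hy, and_true, e₁, e₂, e₃]
    rcases lt_or_gt_of_ne hyc with h | h
    · simp [h, h.trans hc.2, h.not_gt]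
    · simp [h, hc.1.trans h, h.not_gt]
  · simp [hy]

theorem PF_eq_zero_of_notMem (φ : ℝ → ℝ) {x : ℝ} (hx : x ∉ Set.Icc (0:ℝ) 1) :
    P.PF φ x = 0 := by
  have : IsEmpty {y : ℝ // y ∈ Set.Icc (0:ℝ) 1 ∧ P.f y = x} :=
    ⟨fun y => hx (y.2.2 ▸ P.mapsTo y.2.1)⟩
  rw [PF, transfer, tsum_empty]

theorem PF_indicator (φ : ℝ → ℝ) : P.PF ((Set.Icc 0 1).indicator φ) = P.PF φ := by
  funext x
  rw [PF, transfer, transfer]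
  exact tsum_congr fun y => by rw [indicator_of_mem y.2.1]

variable (P) in
/-- The forward orbit of the critical value. -/
def critOrbit : Set ℝ := {y : ℝ | ∃ j : ℕ, 1 ≤ j ∧ P.f^[j] P.c = y}

theorem iterate_mem (j : ℕ) : P.f^[j] P.c ∈ Set.Icc (0:ℝ) 1 :=
  P.mapsTo.iterate j (Ioo_subset_Icc_self P.c_mem)

theorem map_mem_critOrbit {y : ℝ} (hy : y ∈ P.critOrbit) : P.f y ∈ P.critOrbit := by
  obtain ⟨j, -, rfl⟩ := hy
  exact ⟨j + 1, by lia, Function.iterate_succ_apply' _ _ _⟩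

theorem crit_value_mem_critOrbit : P.f P.c ∈ P.critOrbit := ⟨1, le_rfl, rfl⟩

theorem iterate_injective (hdense : Set.Icc (0:ℝ) 1 ⊆ closure P.critOrbit) :
    Function.Injective fun j => P.f^[j] P.c := by
  have main : ∀ i j, i < j → P.f^[i] P.c ≠ P.f^[j] P.c := by
    intro i j hij heq
    have hfin : ∀ n, ∃ m < j, P.f^[n] P.c = P.f^[m] P.c := by
      intro n
      induction n with
      | zero => exact ⟨0, by lia, rfl⟩
      | succ n ih =>
        obtain ⟨m, hm, hnm⟩ := ih
        rw [Function.iterate_succ_apply', hnm, ← Function.iterate_succ_apply' P.f]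
        rcases (Nat.succ_le_of_lt hm).lt_or_eq with h | h
        · exact ⟨m + 1, h, rfl⟩
        · exact ⟨i, hij, by rw [heq, ← h]⟩
    have hsub : P.critOrbit ⊆ (fun m => P.f^[m] P.c) '' Set.Iio j := by
      rintro _ ⟨n, -, rfl⟩
      obtain ⟨m, hm, h⟩ := hfin n
      exact ⟨m, hm, h.symm⟩
    have hF : P.critOrbit.Finite := ((Set.finite_Iio j).image _).subset hsub
    rw [hF.isClosed.closure_eq] at hdense
    exact Set.Icc_infinite zero_lt_one (hF.subset hdense)
  intro i j h
  by_contra hne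
  rcases lt_or_gt_of_ne hne with h' | h'
  · exact main i j h' h
  · exact main j i h' h.symm

theorem exists_preimage (hdense : Set.Icc (0:ℝ) 1 ⊆ closure P.critOrbit) {x : ℝ}
    (hx : x ∈ Set.Icc (0:ℝ) 1) : ∃ y ∈ Set.Icc (0:ℝ) 1, P.f y = x := by
  obtain ⟨F₁, d₁, F₂, d₂, h₁, h₂⟩ := P.exists_branches
  have hc := P.c_mem
  have himage : P.f '' Set.Icc 0 1 = F₁ '' Set.Icc 0 P.c ∪ F₂ '' Set.Icc P.c 1 := by
    rw [image_congr h₁.eq, image_congr h₂.eq, ← image_union, Icc_union_Icc_eq_Icc hc.1.le hc.2.le]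
  have hclosed : IsClosed (P.f '' Set.Icc 0 1) := by
    rw [himage]
    exact ((isCompact_Icc.image F₁.continuous).union (isCompact_Icc.image F₂.continuous)).isClosed
  refine closure_minimal ?_ hclosed (hdense hx)
  rintro _ ⟨j, hj, rfl⟩
  obtain ⟨k, rfl⟩ := Nat.exists_eq_add_of_le' hj
  exact ⟨_, iterate_mem k, (Function.iterate_succ_apply' _ _ _).symm⟩

theorem map_mem_Ioo_of_isBranch {a b : ℝ} {F : ℝ ≃ₜ ℝ} {d : ℝ → ℝ} (h : IsBranch P.f a b F d)
    (hab : Set.Ioo a b ⊆ Set.Icc 0 1) {y : ℝ} (hy : y ∈ Set.Ioo a b) :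
    P.f y ∈ Set.Ioo (0:ℝ) 1 := by
  rw [← h.eq y (Ioo_subset_Icc_self hy), ← interior_Icc]
  refine interior_maximal ?_ (F.isOpenMap _ isOpen_Ioo) (mem_image_of_mem F hy)
  rintro _ ⟨z, hz, rfl⟩
  rw [h.eq z (Ioo_subset_Icc_self hz)]
  exact P.mapsTo (hab hz)

theorem eq_of_map_notMem_Ioo {y : ℝ} (hy : y ∈ Set.Icc (0:ℝ) 1)
    (hfy : P.f y ∉ Set.Ioo (0:ℝ) 1) : y = 0 ∨ y = 1 ∨ y = P.c := by
  obtain ⟨F₁, d₁, F₂, d₂, h₁, h₂⟩ := P.exists_branches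
  have hc := P.c_mem
  by_contra! hne
  rcases lt_or_gt_of_ne hne.2.2 with h | h
  · exact hfy (map_mem_Ioo_of_isBranch h₁ (fun z hz => ⟨hz.1.le, hz.2.le.trans hc.2.le⟩)
      ⟨lt_of_le_of_ne hy.1 hne.1.symm, h⟩)
  · exact hfy (map_mem_Ioo_of_isBranch h₂ (fun z hz => ⟨hc.1.le.trans hz.1.le, hz.2.le⟩)
      ⟨h, lt_of_le_of_ne hy.2 hne.2.1⟩)

theorem crit_value_eq (hdense : Set.Icc (0:ℝ) 1 ⊆ closure P.critOrbit) :
    P.f P.c = 0 ∨ P.f P.c = 1 := by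
  obtain ⟨y, hy, hy0⟩ := exists_preimage hdense (x := 0) (by simp)
  obtain ⟨z, hz, hz1⟩ := exists_preimage hdense (x := 1) (by simp)
  have hc := P.c_mem
  have hlam := P.lam_gt_one
  have he := P.eps_pos
  have hfc := P.mapsTo (Ioo_subset_Icc_self hc)
  have k₁ : P.lam * (P.c - 0) ≤ |P.f P.c - P.f 0| := by
    rw [P.eq₁ P.c (Ioo_subset_Icc_self hc) le_rfl, P.eq₁ 0 (by simp) hc.1.le]
    exact mul_sub_le_abs_sub hc.1 (by linarith)
      (fun x hx => P.expand₁ x ⟨hx.1, by linarith [hx.2]⟩)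
  have k₂ : P.lam * (1 - P.c) ≤ |P.f 1 - P.f P.c| := by
    rw [P.eq₂ P.c (Ioo_subset_Icc_self hc) le_rfl, P.eq₂ 1 (by simp) hc.2.le]
    exact mul_sub_le_abs_sub hc.2 (by linarith)
      (fun x hx => P.expand₂ x ⟨by linarith [hx.1], hx.2⟩)
  rcases eq_of_map_notMem_Ioo (P := P) hy (by simp [hy0]) with rfl | rfl | rfl
  · rcases eq_of_map_notMem_Ioo (P := P) hz (by simp [hz1]) with rfl | rfl | rfl
    · linarith
    · rw [hy0, abs_of_nonneg (by linarith [hfc.1])] at k₁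
      rw [hz1, abs_of_nonneg (by linarith [hfc.2])] at k₂
      linarith
    · exact Or.inr hz1
  · rcases eq_of_map_notMem_Ioo (P := P) hz (by simp [hz1]) with rfl | rfl | rfl
    · rw [hz1, abs_of_nonpos (by linarith [hfc.2])] at k₁
      rw [hy0, abs_of_nonpos (by linarith [hfc.1])] at k₂
      linarith
    · linarith
    · exact Or.inr hz1
  · exact Or.inl hy0

theorem endpoint_mem_critOrbit_or_fixed (hdense : Set.Icc (0:ℝ) 1 ⊆ closure P.critOrbit) {e : ℝ}
    (he : e = 0 ∨ e = 1) : e ∈ P.critOrbit ∨ P.f e = e := by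
  have hfc := P.crit_value_mem_critOrbit
  have key := crit_value_eq hdense
  have hffc := map_mem_critOrbit hfc
  obtain ⟨y, hy, rfl⟩ := exists_preimage hdense (x := e) (by rcases he with rfl | rfl <;> simp)
  have hcases := eq_of_map_notMem_Ioo (P := P) hy (by rcases he with h | h <;> simp [h])
  rcases hcases with h | h | h <;> rcases he with h' | h' <;> rcases key with h'' | h'' <;>
    simp_all

variable (P) in
/-- The critical orbit together with the endpoints of the interval. -/
def singularSet : Set ℝ := P.critOrbit ∪ {0, 1}

theorem map_mem_singularSet (hdense : Set.Icc (0:ℝ) 1 ⊆ closure P.critOrbit) {y : ℝ}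
    (hy : y ∈ P.singularSet) : P.f y ∈ P.singularSet := by
  rcases hy with hy | hy
  · exact Or.inl (map_mem_critOrbit hy)
  · rcases endpoint_mem_critOrbit_or_fixed hdense hy with h | h
    · exact Or.inl (map_mem_critOrbit h)
    · rw [h]
      exact Or.inr hy

theorem crit_notMem_singularSet (hdense : Set.Icc (0:ℝ) 1 ⊆ closure P.critOrbit) :
    P.c ∉ P.singularSet := by
  rintro (⟨j, hj, h⟩ | h | h)
  · have := iterate_injective hdense (a₁ := j) (a₂ := 0) h
    lia
  · exact P.c_mem.1.ne' h
  · exact P.c_mem.2.ne h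

theorem eq_of_mem_singularSet_of_map_eq (hdense : Set.Icc (0:ℝ) 1 ⊆ closure P.critOrbit) {z : ℝ}
    (hz : z ∈ P.singularSet) {j : ℕ} (h : P.f z = P.f (P.f^[j] P.c)) : z = P.f^[j] P.c := by
  have main : z ∈ P.critOrbit → z = P.f^[j] P.c := by
    rintro ⟨i, -, rfl⟩
    rw [← Function.iterate_succ_apply' P.f, ← Function.iterate_succ_apply' P.f] at h
    have := iterate_injective hdense h
    rw [Nat.succ_injective this]
  rcases hz with hz | hz
  · exact main hz
  · rcases endpoint_mem_critOrbit_or_fixed hdense hz with hz | hz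
    · exact main hz
    · refine main ⟨j + 1, by lia, ?_⟩
      rw [Function.iterate_succ_apply', ← h, hz]

theorem continuousAt_PF (hdense : Set.Icc (0:ℝ) 1 ⊆ closure P.critOrbit) {φ : ℝ → ℝ}
    (hφ : ∀ x ∉ P.singularSet, ContinuousAt φ x) {x : ℝ} (hx : x ∉ P.singularSet) :
    ContinuousAt (P.PF φ) x := by
  obtain ⟨F₁, d₁, F₂, d₂, h₁, h₂⟩ := P.exists_branches
  have hc := P.c_mem
  have mem0 : P.f 0 ∈ P.singularSet := map_mem_singularSet hdense (by simp [singularSet])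
  have mem1 : P.f 1 ∈ P.singularSet := map_mem_singularSet hdense (by simp [singularSet])
  have memc : P.f P.c ∈ P.singularSet := Or.inl crit_value_mem_critOrbit
  have key : ∀ {a b : ℝ} {F : ℝ ≃ₜ ℝ} {d : ℝ → ℝ}, IsBranch P.f a b F d → a ≤ b →
      P.f a ∈ P.singularSet → P.f b ∈ P.singularSet → ContinuousAt (branchPush a b F d φ) x := by
    intro a b F d h hab ha hb
    have hval : ∀ y ∈ Set.Icc a b, F.symm x = y → P.f y = x := by
      rintro y hy rfl
      rw [← h.eq _ hy, F.apply_symm_apply]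
    refine h.continuousAt_branchPush (continuousAt_indicator_Ioo ?_ ?_ fun hy => hφ _ ?_)
    · exact fun he => hx (hval a ⟨le_rfl, hab⟩ he ▸ ha)
    · exact fun he => hx (hval b ⟨hab, le_rfl⟩ he ▸ hb)
    · intro hy'
      have := map_mem_singularSet hdense hy'
      rw [hval _ (Ioo_subset_Icc_self hy) rfl] at this
      exact hx this
  refine ((key h₁ hc.1.le mem0 memc).add (key h₂ hc.2.le memc mem1)).congr ?_
  have hne : ∀ p ∈ P.singularSet, ∀ᶠ z in 𝓝 x, z ≠ p := fun p hp =>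
    isOpen_ne.mem_nhds fun h => hx (h ▸ hp)
  filter_upwards [hne _ mem0, hne _ memc, hne _ mem1] with z hz0 hzc hz1
  exact (PF_eq_branchPush_add h₁ h₂ φ hz0 hzc hz1).symm

/-- The invariant density is continuous off the critical orbit and the endpoints. -/
theorem continuousAt_density (hdense : Set.Icc (0:ℝ) 1 ⊆ closure P.critOrbit) {ρ : ℝ → ℝ} {θ : ℝ}
    (hmix : P.Mixing ρ θ) {x : ℝ} (hx : x ∉ P.singularSet) :
    ContinuousAt ((Set.Icc 0 1).indicator ρ) x := by
  set h : ℝ → ℝ := (Set.Icc 0 1).indicator fun _ => 1 with hh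
  have h_cont : ∀ n, ∀ x ∉ P.singularSet, ContinuousAt (P.PF^[n] h) x := by
    intro n
    induction n with
    | zero =>
      intro x hx
      have hx0 : x ≠ 0 := by rintro rfl; exact hx (by simp [singularSet])
      have hx1 : x ≠ 1 := by rintro rfl; exact hx (by simp [singularSet])
      refine (continuousAt_indicator_Ioo (φ := fun _ => (1:ℝ)) hx0 hx1
        fun _ => continuousAt_const).congr ?_
      filter_upwards [isOpen_ne.mem_nhds hx0, isOpen_ne.mem_nhds hx1] with z hz0 hz1
      have : z ∈ Set.Ioo (0:ℝ) 1 ↔ z ∈ Set.Icc (0:ℝ) 1 :=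
        ⟨fun h => Ioo_subset_Icc_self h,
          fun h => ⟨lt_of_le_of_ne h.1 (Ne.symm hz0), lt_of_le_of_ne h.2 hz1⟩⟩
      simp [hh, indicator_apply, -mem_Ioo, -mem_Icc, this]
    | succ n ih =>
      intro x hx
      rw [Function.iterate_succ_apply']
      exact continuousAt_PF hdense ih hx
  have h_out : ∀ n, ∀ x ∉ Set.Icc (0:ℝ) 1, P.PF^[n] h x = 0 := by
    intro n x hx
    cases n with
    | zero => simp only [Function.iterate_zero, id, hh, indicator_of_notMem hx]
    | succ n =>
      rw [Function.iterate_succ_apply']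
      exact PF_eq_zero_of_notMem _ hx
  have h_bv : bvOn h := by
    have hmono : MonotoneOn h (Set.Icc 0 1) := fun x hx y hy _ => by
      simp only [hh, indicator_of_mem hx, indicator_of_mem hy, le_refl]
    have := hmono.locallyBoundedVariationOn 0 1 (by simp) (by simp)
    rwa [inter_self] at this
  have h_int : ∫ z in Set.Icc (0:ℝ) 1, h z = 1 := by
    rw [setIntegral_congr_fun measurableSet_Icc (g := fun _ => (1:ℝ))
      fun z hz => by simp only [hh, indicator_of_mem hz]]
    simp
  obtain ⟨hθ0, hθ1, C, hC, hbound⟩ := hmix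
  have hlim : Tendsto (fun n => C * θ ^ n * bvNorm h) atTop (𝓝 0) := by
    simpa using ((tendsto_pow_atTop_nhds_zero_of_lt_one hθ0.le hθ1).const_mul C).mul_const
      (bvNorm h)
  refine continuousAt_of_locally_uniform_approx_of_continuousAt fun u hu => ?_
  obtain ⟨ε, hε, hεu⟩ := Metric.mem_uniformity_dist.1 hu
  obtain ⟨n, hn⟩ := (hlim.eventually (gt_mem_nhds hε)).exists
  refine ⟨Set.univ, univ_mem, P.PF^[n] h, h_cont n x hx, fun y _ => hεu ?_⟩
  by_cases hy : y ∈ Set.Icc (0:ℝ) 1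
  · have := hbound h h_bv n y hy
    rw [h_int, one_mul] at this
    rw [indicator_of_mem hy, dist_comm, Real.dist_eq]
    exact this.trans_lt hn
  · rwa [indicator_of_notMem hy, h_out n y hy, dist_self]

theorem density_eq_branchPush_add (h₁ : IsBranch P.f 0 P.c F₁ d₁) (h₂ : IsBranch P.f P.c 1 F₂ d₂)
    {ρ : ℝ → ℝ} (hfix : ∀ x ∈ Set.Icc (0:ℝ) 1, P.PF ρ x = ρ x) (p : ℝ) :
    ∀ᶠ x in 𝓝[≠] p, (Set.Icc 0 1).indicator ρ x =
      branchPush 0 P.c F₁ d₁ ((Set.Icc 0 1).indicator ρ) x +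
        branchPush P.c 1 F₂ d₂ ((Set.Icc 0 1).indicator ρ) x := by
  filter_upwards [eventually_ne_punctured p (P.f 0), eventually_ne_punctured p (P.f P.c),
    eventually_ne_punctured p (P.f 1)] with x hx0 hxc hx1
  rw [← PF_eq_branchPush_add h₁ h₂ _ hx0 hxc hx1, PF_indicator]
  by_cases hx : x ∈ Set.Icc (0:ℝ) 1
  · rw [indicator_of_mem hx, hfix x hx]
  · rw [indicator_of_notMem hx, PF_eq_zero_of_notMem _ hx]

theorem not_tendsto_density_crit_value (hdense : Set.Icc (0:ℝ) 1 ⊆ closure P.critOrbit)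
    {ρ : ℝ → ℝ} (hfix : ∀ x ∈ Set.Icc (0:ℝ) 1, P.PF ρ x = ρ x) (hpos : ∀ x, 0 ≤ ρ x)
    (hcont : ContinuousAt ((Set.Icc 0 1).indicator ρ) P.c) (hρc : 0 < ρ P.c) (L : ℝ) :
    ¬ Tendsto ((Set.Icc 0 1).indicator ρ) (𝓝[≠] (P.f P.c)) (𝓝 L) := by
  intro hL
  obtain ⟨F₁, d₁, F₂, d₂, h₁, h₂⟩ := P.exists_branches
  have hc := P.c_mem
  set σ := (Set.Icc (0:ℝ) 1).indicator ρ with hσ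
  have hσpos : ∀ x, 0 ≤ σ x := fun x => indicator_nonneg (fun z _ => hpos z) x
  have hL0 : L = 0 := by
    rcases crit_value_eq hdense with h | h
    · rw [h] at hL
      refine tendsto_nhds_unique
        (hL.mono_left (nhdsLT_le_nhdsNE 0)) ?_
      refine tendsto_const_nhds.congr' ?_
      filter_upwards [self_mem_nhdsWithin] with z hz
      rw [hσ, indicator_of_notMem fun hz' => (not_le.2 hz) hz'.1]
    · rw [h] at hL
      refine tendsto_nhds_unique
        (hL.mono_left (nhdsGT_le_nhdsNE 1)) ?_
      refine tendsto_const_nhds.congr' ?_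
      filter_upwards [self_mem_nhdsWithin] with z hz
      rw [hσ, indicator_of_notMem fun hz' => (not_le.2 hz) hz'.2]
  have hFc : F₁ P.c = P.f P.c := h₁.eq _ ⟨hc.1.le, le_rfl⟩
  have hle : 𝓝[<] P.c ≤ 𝓝[≠] P.c := nhdsLT_le_nhdsNE _
  have hF : Tendsto F₁ (𝓝[<] P.c) (𝓝[≠] (P.f P.c)) :=
    hFc ▸ (tendsto_homeomorph_punctured F₁ P.c).mono_left hle
  have hlow : ∀ᶠ y in 𝓝[<] P.c, σ y / d₁ y ≤ σ (F₁ y) := by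
    have h0 : ∀ᶠ y in 𝓝[<] P.c, 0 < y :=
      mem_nhdsWithin_of_mem_nhds (lt_mem_nhds hc.1)
    filter_upwards [hF.eventually (density_eq_branchPush_add h₁ h₂ hfix _), h0,
      self_mem_nhdsWithin] with y hy hy0 hyc
    have hb : branchPush 0 P.c F₁ d₁ σ (F₁ y) = σ y / d₁ y := by
      rw [branchPush, F₁.symm_apply_apply,
        indicator_of_mem (show y ∈ Set.Ioo 0 P.c from ⟨hy0, hyc⟩)]
    rw [← hσ] at hy
    rw [hy, hb]
    exact le_add_of_nonneg_right (h₂.branchPush_nonneg hσpos _)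
  have hlim : Tendsto (fun y => σ y / d₁ y) (𝓝[<] P.c) (𝓝 (σ P.c / d₁ P.c)) :=
    (hcont.div h₁.cont.continuousAt (h₁.pos _).ne').tendsto.mono_left nhdsWithin_le_nhds
  have := le_of_tendsto_of_tendsto hlim (hL.comp hF) hlow
  rw [hL0, hσ, indicator_of_mem (Ioo_subset_Icc_self hc)] at this
  exact absurd (div_pos hρc (h₁.pos P.c)) (not_lt.2 this)

/-- The invariant density has no limit at any point of the critical orbit. -/
theorem not_tendsto_density (hdense : Set.Icc (0:ℝ) 1 ⊆ closure P.critOrbit)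
    {ρ : ℝ → ℝ} (hfix : ∀ x ∈ Set.Icc (0:ℝ) 1, P.PF ρ x = ρ x) (hpos : ∀ x, 0 ≤ ρ x)
    (hcont : ∀ x ∉ P.singularSet, ContinuousAt ((Set.Icc 0 1).indicator ρ) x)
    (hρc : 0 < ρ P.c) (j : ℕ) (L : ℝ) :
    ¬ Tendsto ((Set.Icc 0 1).indicator ρ) (𝓝[≠] (P.f^[j + 1] P.c)) (𝓝 L) := by
  induction j generalizing L with
  | zero =>
    exact not_tendsto_density_crit_value hdense hfix hpos
      (hcont _ (crit_notMem_singularSet hdense)) hρc L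
  | succ j ih =>
    intro hL
    obtain ⟨F₁, d₁, F₂, d₂, h₁, h₂⟩ := P.exists_branches
    have hc := P.c_mem
    rw [Function.iterate_succ_apply'] at hL
    set y := P.f^[j + 1] P.c with hy
    have hyI : y ∈ Set.Icc (0:ℝ) 1 := iterate_mem _
    have hyS : y ∈ P.singularSet := Or.inl ⟨j + 1, by lia, rfl⟩
    have hyc : y ≠ P.c := fun h => crit_notMem_singularSet hdense (h ▸ hyS)
    have hfyc : P.f P.c ≠ P.f y := by
      intro h
      have := iterate_injective hdense (a₁ := 1) (a₂ := j + 2)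
        (by simpa only [Function.iterate_succ_apply' _ (j + 1), Function.iterate_one] using h)
      lia
    have hrep := density_eq_branchPush_add h₁ h₂ hfix (P.f y)
    have hother : ∀ z, P.f z = P.f y → z ≠ y → z ∉ P.singularSet := fun z hz hzy hzS =>
      hzy (eq_of_mem_singularSet_of_map_eq hdense hzS hz)
    rcases lt_or_gt_of_ne hyc with hlt | hgt
    · obtain ⟨L', hL'⟩ := h₁.exists_limit_of_limit_image h₂ hc.2.le ⟨hyI.1, hlt.le⟩ hrep
        (fun z hz hfz => by
          have hzS := hother z hfz (hlt.trans_le hz.1).ne'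
          exact ⟨fun h => hfyc (h ▸ hfz), fun h => hzS (by simp [h, singularSet]), hcont z hzS⟩) hL
      refine ih L' (hL'.congr' ?_)
      filter_upwards [eventually_ne_punctured y 0,
        mem_nhdsWithin_of_mem_nhds (gt_mem_nhds hlt)] with z hz0 hzc
      by_cases hz : 0 < z
      · rw [indicator_of_mem (show z ∈ Set.Ioo 0 P.c from ⟨hz, hzc⟩)]
      · rw [indicator_of_notMem fun h => hz h.1,
          indicator_of_notMem fun h => hz (lt_of_le_of_ne h.1 (Ne.symm hz0))]
    · obtain ⟨L', hL'⟩ := h₂.exists_limit_of_limit_image h₁ hc.1.le ⟨hgt.le, hyI.2⟩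
        (hrep.mono fun x hx => by rw [hx, add_comm])
        (fun z hz hfz => by
          have hzS := hother z hfz (hz.2.trans_lt hgt).ne
          exact ⟨fun h => hzS (by simp [h, singularSet]), fun h => hfyc (h ▸ hfz), hcont z hzS⟩) hL
      refine ih L' (hL'.congr' ?_)
      filter_upwards [eventually_ne_punctured y 1,
        mem_nhdsWithin_of_mem_nhds (lt_mem_nhds hgt)] with z hz1 hzc
      by_cases hz : z < 1
      · rw [indicator_of_mem (show z ∈ Set.Ioo P.c 1 from ⟨hzc, hz⟩)]
      · rw [indicator_of_notMem fun h => hz h.2,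
          indicator_of_notMem fun h => hz (lt_of_le_of_ne h.2 hz1)]

end PEUM

/-- Theorem 2(B). For a mixing PEUM with `C²` branches whose critical orbit
`{f^j(c)}_{j ≥ 1}` is dense in `[0,1]` and with `ρ(c) > 0`, the set of points of `[0,1]`
where `ρ` is not differentiable is uncountable. -/
theorem nondifferentiability_set_uncountable (P : PEUM) (ρ : ℝ → ℝ) (θ : ℝ)
    (hρ : P.IsInvariantDensity ρ) (hmix : P.Mixing ρ θ) (hρc : 0 < ρ P.c)
    (hdense : ∀ x ∈ Set.Icc (0:ℝ) 1,
      x ∈ closure {y : ℝ | ∃ j : ℕ, 1 ≤ j ∧ P.f^[j] P.c = y}) :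
    ¬ Set.Countable {x ∈ Set.Icc (0:ℝ) 1 | ¬ DifferentiableAt ℝ ρ x} := by
  intro hcount
  obtain ⟨p, r, hr, hsub, hcont⟩ := exists_ball_continuousAt_of_countable hcount
  have hp := Metric.mem_ball_self (x := p) hr
  obtain ⟨_, hq, j, hj, rfl⟩ := mem_closure_iff_nhds.1
    (hdense p (Ioo_subset_Icc_self (hsub hp))) _ (Metric.isOpen_ball.mem_nhds hp)
  obtain ⟨k, rfl⟩ := Nat.exists_eq_add_of_le' hj
  obtain ⟨-, hpos, -, -, hfix⟩ := hρ
  refine PEUM.not_tendsto_density (P := P) hdense hfix hpos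
    (fun x hx => PEUM.continuousAt_density hdense hmix hx) hρc k (ρ (P.f^[k + 1] P.c)) ?_
  refine ((hcont _ hq).tendsto.mono_left nhdsWithin_le_nhds).congr' ?_
  filter_upwards [mem_nhdsWithin_of_mem_nhds (Metric.isOpen_ball.mem_nhds hq)] with z hz
  rw [indicator_of_mem (Ioo_subset_Icc_self (hsub hz))]
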